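/- Let ε > 0, a, b₂, b₃ ∈ ℝ, ν ∈ ℝ³, and set N = (1, −b₂, −b₃) ∈ ℝ³. Let A : ℝ³ × ℝ³ → ℝ³ × ℝ³ be the linear map A(h, e) = (−εa h + ε⟨N, h⟩ν + N × e, −εa e + ε⟨N, e⟩ν − N × h). Then the characteristic polynomial of A equals ((X + εa)² − ‖N‖²)² · (X + ε(a − ⟨ν, N⟩))², where ‖N‖² = 1 + b₂² + b₃². In particular, A has eigenvalues −εa − ‖N‖ and −εa + ‖N‖, each of algebraic multiplicity 2, and the eigenvalue −ε(a − ⟨ν, N⟩) with algebraic multiplicity 2; if a = ⟨ν, N⟩, the latter eigenvalue is 0. -/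

import Mathlib

open Polynomial

/-- Adapted coordinates. -/
noncomputable def coordEquiv (b c : ℝ) : ((Fin 3 → ℝ) × (Fin 3 → ℝ)) ≃ₗ[ℝ] (Fin 6 → ℝ) where
  toFun u := ![u.1 0 - b * u.1 1 - c * u.1 2, u.2 0 - b * u.2 1 - c * u.2 2,
    u.1 1, u.1 2, u.2 1, u.2 2]
  invFun w := (![w 0 + b * w 2 + c * w 3, w 2, w 3], ![w 1 + b * w 4 + c * w 5, w 4, w 5])
  map_add' u v := by
    ext i; fin_cases i <;> simp <;> ring
  map_smul' r u := by
    ext i; fin_cases i <;> simp <;> ring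
  left_inv u := by
    ext i <;> fin_cases i <;> simp <;> ring
  right_inv w := by
    ext i; fin_cases i <;> simp <;> ring

/-- The matrix in adapted coordinates. -/
def adaptedMatrix (k ε b c p q s : ℝ) : Matrix (Fin 6) (Fin 6) ℝ :=
  !![-k + ε * s, 0, 0, 0, 0, 0;
     0, -k + ε * s, 0, 0, 0, 0;
     ε * p, -c, -k, 0, -(b * c), -(1 + c ^ 2);
     ε * q, b, 0, -k, 1 + b ^ 2, b * c;
     c, ε * p, b * c, 1 + c ^ 2, -k, 0;
     -b, ε * q, -(1 + b ^ 2), -(b * c), 0, -k]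

theorem det_first {R : Type*} [CommRing R] {n : ℕ} (M : Matrix (Fin (n + 1)) (Fin (n + 1)) R)
    (h : ∀ j : Fin n, M 0 j.succ = 0) :
    M.det = M 0 0 * (M.submatrix Fin.succ Fin.succ).det := by
  rw [Matrix.det_succ_row_zero, Fin.sum_univ_succ]
  simp [h]

theorem det_four {R : Type*} [CommRing R] (x u v w : R) :
    (!![x, 0, u, v; 0, x, -w, -u; -u, -v, x, 0; w, u, 0, x] : Matrix (Fin 4) (Fin 4) R).det
      = (x ^ 2 + u ^ 2 - v * w) ^ 2 := by
  simp [Matrix.det_succ_row_zero, Fin.sum_univ_succ, Fin.succAbove]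
  ring

theorem charpoly_adapted (k ε b c p q s : ℝ) :
    (adaptedMatrix k ε b c p q s).charpoly =
      ((X + C k) ^ 2 - C (1 + b ^ 2 + c ^ 2)) ^ 2 * (X + C (k - ε * s)) ^ 2 := by
  rw [Matrix.charpoly, det_first _ (by
    intro j
    fin_cases j <;> simp [adaptedMatrix, Matrix.charmatrix_apply]), det_first _ (by
    intro j
    fin_cases j <;> simp [adaptedMatrix, Matrix.charmatrix_apply, Matrix.diagonal])]
  have h4 : ((adaptedMatrix k ε b c p q s).charmatrix.submatrix Fin.succ Fin.succ).submatrix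
      Fin.succ Fin.succ = !![X + C k, 0, C (b * c), C (1 + c ^ 2);
        0, X + C k, -C (1 + b ^ 2), -C (b * c);
        -C (b * c), -C (1 + c ^ 2), X + C k, 0;
        C (1 + b ^ 2), C (b * c), 0, X + C k] := by
    ext1 i j
    fin_cases i <;> fin_cases j <;>
      simp [adaptedMatrix, Matrix.charmatrix_apply, Matrix.diagonal] <;> ring
  rw [h4, det_four]
  simp [adaptedMatrix, Matrix.charmatrix_apply]
  ring

/-- The boundary matrix `−εa I₆ + N_j A_j⁻(ν)` of the reduced 3D vacuum Maxwell system,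
viewed as the linear map `A(h, e) = (−εa h + ε⟨N, h⟩ν + N × e, −εa e + ε⟨N, e⟩ν − N × h)`
with `N = (1, −b₂, −b₃)`, has characteristic polynomial
`((X + εa)² − ‖N‖²)² (X + ε(a − ⟨ν, N⟩))²`, where `‖N‖² = 1 + b₂² + b₃²`; in particular it
has eigenvalues `−εa ± ‖N‖` and `−ε(a − ⟨ν, N⟩)`, and if `a = ⟨ν, N⟩` the latter is `0`. -/
theorem stmt_2 (ε a b₂ b₃ : ℝ) (hε : 0 < ε) (ν : Fin 3 → ℝ)
    (N : Fin 3 → ℝ) (hN : N = ![1, -b₂, -b₃])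
    (A : ((Fin 3 → ℝ) × (Fin 3 → ℝ)) →ₗ[ℝ] ((Fin 3 → ℝ) × (Fin 3 → ℝ)))
    (hA : ∀ u : (Fin 3 → ℝ) × (Fin 3 → ℝ),
      A u = (-(ε * a) • u.1 + (ε * ∑ i, N i * u.1 i) • ν + crossProduct N u.2,
             -(ε * a) • u.2 + (ε * ∑ i, N i * u.2 i) • ν - crossProduct N u.1)) :
    A.charpoly = ((X + C (ε * a)) ^ 2 - C (1 + b₂ ^ 2 + b₃ ^ 2)) ^ 2
        * (X + C (ε * (a - ∑ i, ν i * N i))) ^ 2 ∧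
    Module.End.HasEigenvalue A (-(ε * a) - Real.sqrt (1 + b₂ ^ 2 + b₃ ^ 2)) ∧
    Module.End.HasEigenvalue A (-(ε * a) + Real.sqrt (1 + b₂ ^ 2 + b₃ ^ 2)) ∧
    Module.End.HasEigenvalue A (-(ε * (a - ∑ i, ν i * N i))) ∧
    (a = ∑ i, ν i * N i → Module.End.HasEigenvalue A 0) := by
  have hch : A.charpoly = ((X + C (ε * a)) ^ 2 - C (1 + b₂ ^ 2 + b₃ ^ 2)) ^ 2
        * (X + C (ε * (a - ∑ i, ν i * N i))) ^ 2 := by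
    have h1 : LinearMap.toMatrix (Module.Basis.ofEquivFun (coordEquiv b₂ b₃))
        (Module.Basis.ofEquivFun (coordEquiv b₂ b₃)) A
        = Matrix.of (fun i j => coordEquiv b₂ b₃ (A ((coordEquiv b₂ b₃).symm (Pi.single j 1))) i) := by
      ext i j
      simp [LinearMap.toMatrix_apply]
    rw [← LinearMap.charpoly_toMatrix A (Module.Basis.ofEquivFun (coordEquiv b₂ b₃)), h1]
    have h2 : Matrix.of (fun i j => coordEquiv b₂ b₃ (A ((coordEquiv b₂ b₃).symm (Pi.single j 1))) i)
        = adaptedMatrix (ε * a) ε b₂ b₃ (ν 1) (ν 2) (∑ i, ν i * N i) := by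
      subst hN
      ext i j
      rw [Matrix.of_apply, hA]
      fin_cases i <;> fin_cases j <;>
        simp [coordEquiv, adaptedMatrix, Fin.sum_univ_three, crossProduct,
          Matrix.vecHead, Matrix.vecTail] <;> ring
    rw [h2, charpoly_adapted, mul_sub]
  refine ⟨hch, ?_, ?_, ?_, ?_⟩
  · rw [Module.End.hasEigenvalue_iff_isRoot_charpoly, hch]
    have := Real.sq_sqrt (show 0 ≤ 1 + b₂ ^ 2 + b₃ ^ 2 by positivity)
    simp
    left
    linear_combination this
  · rw [Module.End.hasEigenvalue_iff_isRoot_charpoly, hch]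
    have := Real.sq_sqrt (show 0 ≤ 1 + b₂ ^ 2 + b₃ ^ 2 by positivity)
    simp [this]
  · rw [Module.End.hasEigenvalue_iff_isRoot_charpoly, hch]
    generalize (∑ i, ν i * N i) = s
    simp
  · intro h
    rw [Module.End.hasEigenvalue_iff_isRoot_charpoly, hch]
    simp [← h]
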